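/- arXiv:2412.11617 — 11 statements merged into one kernel-verified Lean document; each statement's English description precedes it below -/
import Mathlib

section
/- Let F = (A, R) be an AF without self-attacking arguments and C_F = ⟨T, F⟩ its conflict database. Then for every S ⊆ A: S is conflict-free in F if and only if S_T is a repair of C_F. -/
open scoped Classical

universe u

/-- A dependency (functional or inclusion) over an attribute type `α`.
`fd X Y` is the functional dependency `X → Y`; `id X Y` is the inclusion dependency `X ⊆ Y`. -/
inductive Dep (α : Type u) : Type u
  | fd (X Y : List α) : Dep α
  | id (X Y : List α) : Dep α

/-- Satisfaction of a dependency by a set `P` of tuples; tuples are identified by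
elements of `ι`, and `val t x` is the value taken by tuple `t` at attribute `x`. -/
def satDep {ι α V : Type*} (val : ι → α → V) (P : Set ι) : Dep α → Prop
  | Dep.fd X Y => ∀ s ∈ P, ∀ t ∈ P, X.map (val s) = X.map (val t) → Y.map (val s) = Y.map (val t)
  | Dep.id X Y => ∀ s ∈ P, ∃ t ∈ P, X.map (val s) = Y.map (val t)

/-- `P` is a repair of the database instance `⟨T, B⟩`: `P ⊆ T` and `P` satisfies
every dependency in `B`. -/
def IsRepair {ι α V : Type*} (val : ι → α → V) (T : Set ι) (B : Set (Dep α)) (P : Set ι) : Prop :=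
  P ⊆ T ∧ ∀ d ∈ B, satDep val P d

/-- `P` is a maximal repair of `⟨T, B⟩`: a repair such that no repair strictly contains it. -/
def IsMaximalRepair {ι α V : Type*} (val : ι → α → V) (T : Set ι) (B : Set (Dep α))
    (P : Set ι) : Prop :=
  IsRepair val T B P ∧ ∀ P' : Set ι, IsRepair val T B P' → ¬ P ⊂ P'

/-- `supp(X ⊆ Y, s)`: the set of tuples of `T` supporting `s` for the inclusion
dependency `X ⊆ Y`. -/
def suppOf {ι α V : Type*} (val : ι → α → V) (T : Set ι) (X Y : List α) (s : ι) : Set ι :=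
  {t ∈ T | Y.map (val t) = X.map (val s)}

/-- `dom(P[X])`: the set of values taken by the tuples of `P` on the attributes in `X`. -/
def domOn {ι α V : Type*} (val : ι → α → V) (P : Set ι) (X : Set α) : Set V :=
  {v | ∃ s ∈ P, ∃ x ∈ X, val s x = v}

/-- `S` is conflict-free in the AF `(A, R)`. -/
def ConfFree {A : Type u} (R : A → A → Prop) (S : Set A) : Prop :=
  ∀ a ∈ S, ∀ b ∈ S, ¬ R a b

/-- `S` is naive in the AF `(A, R)`. -/
def NaiveExt {A : Type u} (R : A → A → Prop) (S : Set A) : Prop :=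
  ConfFree R S ∧ ∀ S' : Set A, ConfFree R S' → ¬ S ⊂ S'

/-- The argument `a` is defended by `S` in the AF `(A, R)`. -/
def Defends {A : Type u} (R : A → A → Prop) (S : Set A) (a : A) : Prop :=
  ∀ b, R b a → ∃ c ∈ S, R c b

/-- `S` is admissible in the AF `(A, R)`. -/
def AdmissibleExt {A : Type u} (R : A → A → Prop) (S : Set A) : Prop :=
  ConfFree R S ∧ ∀ a ∈ S, Defends R S a

/-- `S` is preferred in the AF `(A, R)`. -/
def PreferredExt {A : Type u} (R : A → A → Prop) (S : Set A) : Prop :=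
  AdmissibleExt R S ∧ ∀ S' : Set A, AdmissibleExt R S' → ¬ S ⊂ S'

/-- The range `S⁺` of `S` in the AF `(A, R)`. -/
def AFRange {A : Type u} (R : A → A → Prop) (S : Set A) : Set A :=
  S ∪ {a | ∃ b ∈ S, R b a}

/-- `S` is stable in the AF `(A, R)`. -/
def StableExt {A : Type u} (R : A → A → Prop) (S : Set A) : Prop :=
  ConfFree R S ∧ ∀ b, b ∉ S → ∃ a ∈ S, R a b

/-- `S` is stage in the AF `(A, R)`. -/
def StageExt {A : Type u} (R : A → A → Prop) (S : Set A) : Prop :=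
  ConfFree R S ∧ ∀ S' : Set A, ConfFree R S' → ¬ AFRange R S ⊂ AFRange R S'

/-- `S` is semi-stable in the AF `(A, R)`. -/
def SemiStableExt {A : Type u} (R : A → A → Prop) (S : Set A) : Prop :=
  AdmissibleExt R S ∧ ∀ S' : Set A, AdmissibleExt R S' → ¬ AFRange R S ⊂ AFRange R S'

/-- `r` is a conflict of the AF `(A, R)`: an unordered pair `{a, b}` with an attack between
`a` and `b` (in either direction). -/
def IsConflict {A : Type u} (R : A → A → Prop) (r : Sym2 A) : Prop :=
  ∃ a b : A, r = s(a, b) ∧ (R a b ∨ R b a)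

/-- Valuation of the conflict database `C_F`: one tuple `𝐚` per argument `a`, over the
attributes `x_r` (`some r`, for conflicts `r`) and the name attribute `n` (`none`), with
`𝐚[n] = a`, `𝐚[x_r] = r` if `a ∈ r`, and `𝐚[x_r] = a` otherwise. -/
noncomputable def confVal {A : Type u} (R : A → A → Prop) (a : A) :
    Option {r : Sym2 A // IsConflict R r} → A ⊕ Sym2 A
  | none => Sum.inl a
  | some r => if a ∈ r.1 then Sum.inr r.1 else Sum.inl a

/-- The dependencies of the conflict database: the FDs `x_r → n` for conflicts `r`. -/
def confDeps {A : Type u} (R : A → A → Prop) :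
    Set (Dep (Option {r : Sym2 A // IsConflict R r})) :=
  {d | ∃ r : {r : Sym2 A // IsConflict R r}, d = Dep.fd [some r] [none]}

/-- Valuation of the defense database `D_F`: attribute `u_b` is `Sum.inl b`, attribute
`v_b` is `Sum.inr b`, and the value `0` is `none`. -/
noncomputable def defVal {A : Type u} (R : A → A → Prop) (a : A) : A ⊕ A → Option A
  | Sum.inl b => if R a b ∨ R b a then some b else none
  | Sum.inr b => if R a b then some b else none

/-- The dependencies of the defense database: the IDs `u_a ⊆ v_a` for `a ∈ A`. -/
def defDeps {A : Type u} (R : A → A → Prop) : Set (Dep (A ⊕ A)) :=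
  {d | ∃ a : A, d = Dep.id [Sum.inl a] [Sum.inr a]}

/-- `r` is a conflict of `(A, R)` on two distinct arguments. -/
def AFConflict {A : Type u} (R : A → A → Prop) (r : Sym2 A) : Prop :=
  ∃ a b : A, r = s(a, b) ∧ a ≠ b ∧ (R a b ∨ R b a)

/-- Attributes of the AF-database `A_F`: `x_r` for conflicts `r` on distinct arguments, the
name attribute `n`, the defense attributes `u_a, v_a` for `a ∈ A`, and `u_s, v_s`. -/
abbrev AFAttr (A : Type u) (R : A → A → Prop) :=
  ({r : Sym2 A // AFConflict R r} ⊕ Unit) ⊕ ((A ⊕ A) ⊕ (Unit ⊕ Unit))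

/-- Valuation of the AF-database `A_F`; the fresh value `0` is `none`. -/
noncomputable def afVal {A : Type u} (R : A → A → Prop) (a : A) :
    AFAttr A R → Option (A ⊕ Sym2 A)
  | Sum.inl (Sum.inl r) => if a ∈ r.1 then some (Sum.inr r.1) else some (Sum.inl a)
  | Sum.inl (Sum.inr _) => some (Sum.inl a)
  | Sum.inr (Sum.inl (Sum.inl b)) =>
      if a ≠ b ∧ (R a b ∨ R b a) then some (Sum.inl b) else none
  | Sum.inr (Sum.inl (Sum.inr b)) =>
      if a ≠ b ∧ R a b then some (Sum.inl b) else none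
  | Sum.inr (Sum.inr (Sum.inl _)) => if R a a then some (Sum.inl a) else none
  | Sum.inr (Sum.inr (Sum.inr _)) => none

/-- The FDs `x_r → n` of the AF-database. -/
def afFDs (A : Type u) (R : A → A → Prop) : Set (Dep (AFAttr A R)) :=
  {d | ∃ r : {r : Sym2 A // AFConflict R r},
    d = Dep.fd [Sum.inl (Sum.inl r)] [Sum.inl (Sum.inr ())]}

/-- The IDs `u_a ⊆ v_a` of the AF-database. -/
def afIDs (A : Type u) (R : A → A → Prop) : Set (Dep (AFAttr A R)) :=
  {d | ∃ a : A, d = Dep.id [Sum.inr (Sum.inl (Sum.inl a))] [Sum.inr (Sum.inl (Sum.inr a))]}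

/-- The ID `i_s = (u_s ⊆ v_s)` for self-attacking arguments. -/
def afIs (A : Type u) (R : A → A → Prop) : Dep (AFAttr A R) :=
  Dep.id [Sum.inr (Sum.inr (Sum.inl ()))] [Sum.inr (Sum.inr (Sum.inr ()))]

/-- All dependencies `F ∪ I ∪ {i_s}` of the AF-database. -/
def afDeps (A : Type u) (R : A → A → Prop) : Set (Dep (AFAttr A R)) :=
  afFDs A R ∪ afIDs A R ∪ {afIs A R}

/-- The range attributes `X_r = {v_a : a ∈ A} ∪ {n}`. -/
def rangeAttrs (A : Type u) (R : A → A → Prop) : Set (AFAttr A R) :=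
  {x | (∃ a : A, x = Sum.inr (Sum.inl (Sum.inr a))) ∨ x = Sum.inl (Sum.inr ())}

/-- For an AF `F = (A, R)` without self-attacking arguments and its
conflict database `C_F`, a set `S ⊆ A` is conflict-free in `F` iff the corresponding
set of tuples `S_T` is a repair of `C_F`. -/
theorem conflictFree_iff_repair {A : Type u} [Fintype A] [Nonempty A] (R : A → A → Prop)
    (hself : ∀ a : A, ¬ R a a) (S : Set A) :
    ConfFree R S ↔ IsRepair (confVal R) Set.univ (confDeps R) S := by
  constructor
  · intro h
    refine ⟨Set.subset_univ S, ?_⟩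
    rintro _ ⟨⟨_, c, d, rfl, hcd⟩, rfl⟩ a ha b hb hab
    have hac := h a ha b hb
    have hba := h b hb a ha
    simp only [List.map_cons, List.map_nil, List.cons.injEq, and_true, confVal,
      Sum.inl.injEq, Sym2.mem_iff] at hab ⊢
    split_ifs at hab <;> grind
  · rintro ⟨-, h⟩ a ha b hb hab
    have hr : IsConflict R s(a, b) := ⟨a, b, rfl, Or.inl hab⟩
    have key := h _ ⟨⟨s(a, b), hr⟩, rfl⟩ a ha b hb (by simp [confVal])
    obtain rfl : a = b := by simpa [confVal] using key
    exact hself a hab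
end

section
/- Let F = (A, R) be an AF without self-attacking arguments and C_F = ⟨T, F⟩ its conflict database. Then for every S ⊆ A: S is naive in F if and only if S_T is a maximal repair of C_F. -/
open scoped Classical

universe u

theorem isRepair_confDeps_iff {A : Type u} (R : A → A → Prop) (hself : ∀ a : A, ¬ R a a)
    (P : Set A) : IsRepair (confVal R) Set.univ (confDeps R) P ↔ ConfFree R P := by
  constructor
  · rintro ⟨-, hP⟩ a ha b hb hab
    have h := hP _ ⟨⟨s(a, b), a, b, rfl, Or.inl hab⟩, rfl⟩ a ha b hb (by simp [confVal])
    obtain rfl : a = b := by simpa [confVal] using h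
    exact hself a hab
  · refine fun hP => ⟨Set.subset_univ P, ?_⟩
    rintro _ ⟨⟨r, hr⟩, rfl⟩ s hs t ht hst
    suffices s = t by rw [this]
    by_cases h₁ : s ∈ r <;> by_cases h₂ : t ∈ r <;> simp [confVal, h₁, h₂] at hst
    · obtain ⟨a, b, rfl, hab⟩ := hr
      rw [Sym2.mem_iff] at h₁ h₂
      have hst₁ := hP s hs t ht
      have hst₂ := hP t ht s hs
      grind
    · exact hst

/-- For an AF `F = (A, R)` without self-attacking arguments and its
conflict database `C_F`, a set `S ⊆ A` is naive in `F` iff the corresponding set of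
tuples `S_T` is a maximal repair of `C_F`. -/
theorem naive_iff_maximalRepair {A : Type u} [Fintype A] [Nonempty A] (R : A → A → Prop)
    (hself : ∀ a : A, ¬ R a a) (S : Set A) :
    NaiveExt R S ↔ IsMaximalRepair (confVal R) Set.univ (confDeps R) S := by
  simp only [NaiveExt, IsMaximalRepair, isRepair_confDeps_iff R hself]
end

section
/- Let C_F = ⟨T, F⟩ be the conflict database of an AF F = (A, R) without self-attacking arguments, and let r_i = {a_i, b_i} and r_j = {a_j, b_j} be two conflicts of F on four pairwise distinct arguments, with associated FDs f_i = (x_i → n) and f_j = (x_j → n). Let ⟨T', F'⟩ be obtained from C_F by deleting the attributes x_i and x_j, adding a fresh attribute x_k with 𝐚_i[x_k] = r_i = 𝐛_i[x_k], 𝐚_j[x_k] = r_j = 𝐛_j[x_k], and 𝐜[x_k] = c for every other argument c, and replacing f_i and f_j in F by f_k = (x_k → n). Then for every P ⊆ T and the corresponding set P' of modified tuples: P satisfies both f_i and f_j if and only if P' satisfies f_k. -/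
open scoped Classical

universe u

/-- Valuation of the modified conflict database: attributes `x_i, x_j` are deleted
(only the conflicts `r ∉ {r_i, r_j}` keep their attributes `some (Sum.inl r)`), and a
fresh attribute `x_k = some (Sum.inr ())` is added with `𝐚_i[x_k] = r_i = 𝐛_i[x_k]`,
`𝐚_j[x_k] = r_j = 𝐛_j[x_k]`, and `𝐜[x_k] = c` for every other argument `c`. -/
noncomputable def mergedVal {A : Type u} (R : A → A → Prop) (ai bi aj bj : A) (a : A) :
    Option ({r : Sym2 A // IsConflict R r ∧ r ≠ s(ai, bi) ∧ r ≠ s(aj, bj)} ⊕ Unit) →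
      A ⊕ Sym2 A
  | none => Sum.inl a
  | some (Sum.inl r) => if a ∈ r.1 then Sum.inr r.1 else Sum.inl a
  | some (Sum.inr _) =>
      if a ∈ s(ai, bi) then Sum.inr s(ai, bi)
      else if a ∈ s(aj, bj) then Sum.inr s(aj, bj)
      else Sum.inl a

/-- The FD `x_r → n` of the conflict database says that at most one argument of `r` is chosen. -/
theorem satDep_confVal_iff {A : Type u} (R : A → A → Prop) (P : Set A)
    (r : {r : Sym2 A // IsConflict R r}) :
    satDep (confVal R) P (Dep.fd [some r] [none]) ↔
      ∀ a ∈ P, ∀ b ∈ P, a ∈ r.1 → b ∈ r.1 → a = b := by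
  simp only [satDep, confVal, List.map_cons, List.map_nil, List.cons.injEq, and_true,
    Sum.inl.injEq]
  refine forall₄_congr fun a _ b _ => ?_
  split_ifs <;> simp_all

/-- Let `r_i = {a_i, b_i}` and `r_j = {a_j, b_j}` be two conflicts of an
AF without self-attacks on four pairwise distinct arguments, with FDs `f_i = (x_i → n)`
and `f_j = (x_j → n)` in the conflict database, and let the modified database replace
`x_i, x_j` by a fresh attribute `x_k` and `f_i, f_j` by `f_k = (x_k → n)`. Then for every
`P ⊆ T` (with corresponding modified tuples `P'`): `P` satisfies both `f_i` and `f_j`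
iff `P'` satisfies `f_k`. -/
theorem merged_fd_iff {A : Type u} [Fintype A] [Nonempty A] (R : A → A → Prop)
    (hself : ∀ a : A, ¬ R a a) (ai bi aj bj : A)
    (hdist : [ai, bi, aj, bj].Pairwise (· ≠ ·))
    (hi : R ai bi ∨ R bi ai) (hj : R aj bj ∨ R bj aj) (P : Set A) :
    (satDep (confVal R) P (Dep.fd [some ⟨s(ai, bi), ⟨ai, bi, rfl, hi⟩⟩] [none]) ∧
        satDep (confVal R) P (Dep.fd [some ⟨s(aj, bj), ⟨aj, bj, rfl, hj⟩⟩] [none])) ↔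
      satDep (mergedVal R ai bi aj bj) P (Dep.fd [some (Sum.inr ())] [none]) := by
  simp only [List.pairwise_cons, List.mem_cons, List.not_mem_nil, or_false] at hdist
  have hdisj : ∀ a ∈ s(ai, bi), a ∉ s(aj, bj) := by
    intro a
    simp only [Sym2.mem_iff]
    grind
  have hne : s(ai, bi) ≠ s(aj, bj) := fun h =>
    hdisj ai (Sym2.mem_mk_left ai bi) (h ▸ Sym2.mem_mk_left ai bi)
  rw [satDep_confVal_iff, satDep_confVal_iff]
  simp only [satDep, mergedVal, List.map_cons, List.map_nil, List.cons.injEq, and_true,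
    Sum.inl.injEq]
  generalize s(ai, bi) = ri, s(aj, bj) = rj at hdisj hne ⊢
  constructor
  · rintro ⟨hri, hrj⟩ a ha b hb hab
    grind
  · intro h
    constructor <;> intro a ha b hb har hbr <;> apply h a ha b hb <;> grind
end

section
/- Let F = (A, R) be an AF without self-attacking arguments whose degree (the maximum, over arguments a ∈ A, of the number of arguments attacking a or attacked by a) is γ. Then there exists a database instance ⟨T', F'⟩ whose tuples are in bijection with A and whose dependency set F' consists of at most γ + 1 functional dependencies, such that for every S ⊆ A: S is conflict-free in F if and only if the corresponding set of tuples S_{T'} is a repair of ⟨T', F'⟩. -/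
open scoped Classical

universe u

/-- The graph joining each vertex to its image under `f`; when `f` is idempotent this is a
star forest whose centers are the fixed points of `f`. -/
def starGraph {A : Type*} (f : A → A) : SimpleGraph A :=
  SimpleGraph.fromRel fun a b => f a = b

theorem starGraph_adj {A : Type*} {f : A → A} {a b : A} :
    (starGraph f).Adj a b ↔ a ≠ b ∧ (f a = b ∨ f b = a) :=
  SimpleGraph.fromRel_adj _ a b

/-- In a star forest, adjacency means having the same center while exactly one of the two
vertices is a center. -/
theorem starGraph_adj_iff_of_idempotent {A : Type*} {f : A → A} (hf : ∀ a, f (f a) = f a)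
    {a b : A} : (starGraph f).Adj a b ↔ f a = f b ∧ ¬ (f a = a ↔ f b = b) := by
  have ha := hf a
  have hb := hf b
  rw [starGraph_adj]
  grind

/-- A star forest in `G` missing a non-isolated vertex `v` of `G` can be modified so as to
cover `v` without uncovering any vertex. -/
theorem exists_starGraph_cover_insert {A : Type*} (G : SimpleGraph A) {f : A → A}
    (hf : ∀ a, f (f a) = f a) (hG : starGraph f ≤ G) {v u : A} (hvu : G.Adj v u)
    (hv : ∀ w, ¬ (starGraph f).Adj v w) :
    ∃ g : A → A, (∀ a, g (g a) = g a) ∧ starGraph g ≤ G ∧ (starGraph g).Adj v u ∧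
      ∀ a, (∃ w, (starGraph f).Adj a w) → ∃ w, (starGraph g).Adj a w := by
  have hne : v ≠ u := hvu.ne
  have hG' : ∀ a, f a ≠ a → G.Adj a (f a) := fun a ha =>
    hG (starGraph_adj.2 ⟨ha.symm, Or.inl rfl⟩)
  have of_adj : ∀ g : A → A, (∀ a, g a ≠ a → G.Adj a (g a)) → starGraph g ≤ G := by
    intro g hg a b hab
    obtain ⟨h, rfl | rfl⟩ := starGraph_adj.1 hab
    · exact hg a h.symm
    · exact (hg b h).symm
  simp only [starGraph_adj] at hv ⊢
  have hfv : f v = v := by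
    by_contra h
    exact hv (f v) ⟨fun e => h e.symm, Or.inl rfl⟩
  have hfv' : ∀ w, f w = v → w = v := by
    intro w hw
    by_contra h
    exact hv w ⟨fun e => h e.symm, Or.inr hw⟩
  by_cases hu : f u = u
  · refine ⟨fun a => if a = v then u else f a, ?_, of_adj _ ?_, ?_, ?_⟩
    · grind
    · grind
    · grind
    · rintro a ⟨w, haw, hw⟩
      exact ⟨w, by grind⟩
  · have hadj : G.Adj u (f u) := hG' u hu
    by_cases hc : ∃ w, w ≠ u ∧ w ≠ f u ∧ f w = f u
    · obtain ⟨w₀, hw₀u, hw₀c, hw₀⟩ := hc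
      refine ⟨fun a => if a = v ∨ a = u then u else f a, ?_, of_adj _ ?_, ?_, ?_⟩
      · grind
      · grind
      · grind
      · rintro a ⟨w, haw, hw⟩
        by_cases hau : a = u
        · exact ⟨v, by grind⟩
        · by_cases hac : a = f u
          · exact ⟨w₀, by grind⟩
          · exact ⟨w, by grind⟩
    · push Not at hc
      refine ⟨fun a => if a = v ∨ a = u ∨ a = f u then u else f a, ?_, of_adj _ ?_, ?_, ?_⟩
      · grind
      · have := hadj.symm
        grind
      · grind
      · rintro a ⟨w, haw, hw⟩
        by_cases hau : a = u
        · exact ⟨v, by grind⟩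
        · by_cases hac : a = f u
          · exact ⟨u, by grind⟩
          · exact ⟨w, by grind⟩

/-- Every finite graph contains a star forest covering all its non-isolated vertices. -/
theorem exists_starGraph_cover {A : Type*} [Finite A] (G : SimpleGraph A) :
    ∃ f : A → A, (∀ a, f (f a) = f a) ∧ starGraph f ≤ G ∧
      ∀ a b, G.Adj a b → ∃ w, (starGraph f).Adj a w := by
  cases nonempty_fintype A
  suffices h : ∀ s : Finset A, ∃ f : A → A, (∀ a, f (f a) = f a) ∧ starGraph f ≤ G ∧
      ∀ a ∈ s, ∀ b, G.Adj a b → ∃ w, (starGraph f).Adj a w by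
    simpa using h Finset.univ
  intro s
  induction s using Finset.induction_on with
  | empty =>
    refine ⟨id, fun _ => rfl, fun a b hab => ?_, by simp⟩
    obtain ⟨h, rfl | rfl⟩ := starGraph_adj.1 hab <;> exact absurd rfl h
  | insert v s _ ih =>
    obtain ⟨f, hf, hG, hs⟩ := ih
    by_cases hv : ∃ u, G.Adj v u ∧ ∀ w, ¬ (starGraph f).Adj v w
    · obtain ⟨u, hvu, hv⟩ := hv
      obtain ⟨g, hg, hgG, hgv, hgs⟩ := exists_starGraph_cover_insert G hf hG hvu hv
      refine ⟨g, hg, hgG, fun a ha b hab => ?_⟩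
      rcases Finset.mem_insert.1 ha with rfl | ha
      · exact ⟨u, hgv⟩
      · exact hgs a (hs a ha b hab)
    · push Not at hv
      refine ⟨f, hf, hG, fun a ha b hab => ?_⟩
      rcases Finset.mem_insert.1 ha with rfl | ha
      · exact hv b hab
      · exact hs a ha b hab

/-- A finite graph of maximum degree at most `n` is a union of `n` star forests. -/
theorem exists_starGraph_decomposition {A : Type*} [Fintype A] (n : ℕ) (G : SimpleGraph A)
    (hG : ∀ a, (Finset.univ.filter (G.Adj a)).card ≤ n) :
    ∃ f : Fin n → A → A, (∀ i a, f i (f i a) = f i a) ∧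
      ∀ a b, G.Adj a b ↔ ∃ i, (starGraph (f i)).Adj a b := by
  induction n generalizing G with
  | zero =>
    refine ⟨Fin.elim0, fun i => i.elim0, fun a b => ⟨fun hab => ?_, fun ⟨i, _⟩ => i.elim0⟩⟩
    exact absurd (hG a) (Nat.not_le.2 (Finset.card_pos.2 ⟨b, by simpa using hab⟩))
  | succ n ih =>
    obtain ⟨g, hg, hgG, hcov⟩ := exists_starGraph_cover G
    obtain ⟨f, hf, hfG⟩ := ih (G \ starGraph g) fun a => by
      by_cases ha : ∃ b, G.Adj a b
      · obtain ⟨b, hab⟩ := ha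
        obtain ⟨w, hw⟩ := hcov a b hab
        refine Nat.le_of_lt_succ (lt_of_lt_of_le (Finset.card_lt_card ?_) (hG a))
        refine (Finset.ssubset_iff_of_subset fun x hx => ?_).2 ⟨w, ?_, ?_⟩
        · simp only [Finset.mem_filter_univ, SimpleGraph.sdiff_adj] at hx ⊢
          exact hx.1
        · simpa using hgG hw
        · simp [hw]
      · push Not at ha
        simp [ha]
    refine ⟨Fin.cons g f, Fin.cases hg hf, fun a b => ?_⟩
    rw [Fin.exists_fin_succ]
    simp only [Fin.cons_zero, Fin.cons_succ, ← hfG, SimpleGraph.sdiff_adj]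
    have := @hgG a b
    tauto

/-- For an AF `F = (A, R)` without self-attacking arguments of degree `γ`
(the maximum over arguments `a` of the number of arguments attacking `a` or attacked by
`a`), there is a database instance whose tuples are in bijection with `A` (one tuple per
argument) and whose dependency set consists of at most `γ + 1` functional dependencies,
such that for every `S ⊆ A`: `S` is conflict-free in `F` iff the corresponding set of
tuples is a repair of the instance. -/
theorem conflictFree_repair_few_fds {A : Type u} [Fintype A] [Nonempty A]
    (R : A → A → Prop) (hself : ∀ a : A, ¬ R a a) (γ : ℕ)
    (hγ : (Finset.univ : Finset A).sup
        (fun a => (Finset.univ.filter fun b : A => R a b ∨ R b a).card) = γ) :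
    ∃ (α V : Type u) (val : A → α → V) (Fs : Finset (Dep α)),
      Fs.card ≤ γ + 1 ∧
      (∀ d ∈ Fs, ∃ X Y, d = Dep.fd X Y) ∧
      ∀ S : Set A, ConfFree R S ↔ IsRepair val Set.univ (↑Fs) S := by
  let G : SimpleGraph A :=
    { Adj := fun a b => R a b ∨ R b a
      symm := ⟨fun _ _ h => h.symm⟩
      loopless := ⟨fun a h => h.elim (hself a) (hself a)⟩ }
  obtain ⟨f, hf, hfG⟩ := exists_starGraph_decomposition γ G fun a => by
    rw [← hγ]
    refine le_of_eq_of_le ?_ (Finset.le_sup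
      (f := fun a => (Finset.univ.filter fun b : A => R a b ∨ R b a).card) (Finset.mem_univ a))
    congr!
  refine ⟨ULift (Fin γ × Bool), Option A,
    fun a x => if x.down.2 ∧ f x.down.1 a = a then none else some (f x.down.1 a),
    Finset.univ.image fun i => Dep.fd [⟨i, false⟩] [⟨i, true⟩], ?_, ?_, fun S => ?_⟩
  · exact (Finset.card_image_le.trans_eq (by simp)).trans γ.le_succ
  · intro d hd
    obtain ⟨i, -, rfl⟩ := Finset.mem_image.1 hd
    exact ⟨_, _, rfl⟩
  have hconf : ConfFree R S ↔ ∀ a ∈ S, ∀ b ∈ S, ∀ i, ¬ (starGraph (f i)).Adj a b := by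
    have hadj : ∀ a b, (∀ i, ¬ (starGraph (f i)).Adj a b) ↔ ¬ (R a b ∨ R b a) := fun a b => by
      rw [← not_exists, ← hfG]
    simp only [hadj]
    exact ⟨fun h a ha b hb hab => hab.elim (h a ha b hb) (h b hb a ha),
      fun h a ha b hb hab => h a ha b hb (Or.inl hab)⟩
  rw [hconf]
  simp only [IsRepair, Set.subset_univ, true_and, Finset.coe_image, Finset.coe_univ,
    Set.image_univ, Set.forall_mem_range, satDep, List.map_cons, List.map_nil,
    starGraph_adj_iff_of_idempotent (hf _)]
  refine ⟨fun h i a ha b hb => ?_, fun h a ha b hb i => ?_⟩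
  · have := h a ha b hb i
    grind
  · have := h i a ha b hb
    grind
end

section
/- Let F = (A, R) be an AF without self-attacking arguments with |A| = m arguments. Then there exists a database instance ⟨T', F'⟩ with exactly m tuples, at most m + 1 attributes, and at most m functional dependencies such that for every S ⊆ A: S is conflict-free in F if and only if the corresponding set of tuples S_{T'} is a repair of ⟨T', F'⟩, and S is naive in F if and only if S_{T'} is a maximal repair of ⟨T', F'⟩. -/
open scoped Classical

universe u

/-- The partner of `a` in the matching of colour `c`, for the edge colouring of the complete
graph on `A` in which `{a, b}` has colour `a + b`, addition being transported along `e`. -/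
def matchingPartner {A G : Type*} [AddCommGroup G] (e : A ≃ G) (c a : A) : A :=
  e.symm (e c - e a)

theorem matchingPartner_add {A G : Type*} [AddCommGroup G] (e : A ≃ G) (a b : A) :
    matchingPartner e (e.symm (e a + e b)) a = b := by
  simp [matchingPartner]

theorem matchingPartner_add_right {A G : Type*} [AddCommGroup G] (e : A ≃ G) (a b : A) :
    matchingPartner e (e.symm (e a + e b)) b = a := by
  simp [matchingPartner]

/-- Valuation with one attribute `some c` per colour and a name attribute `none`: on `some c`,
two distinct tuples agree iff they are in conflict and matched in colour `c`. -/
noncomputable def matchingVal {A : Type u} {G : Type*} [AddCommGroup G] (R : A → A → Prop)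
    (e : A ≃ G) (a : A) : Option A → Sym2 A
  | none => s(a, a)
  | some c =>
      if R a (matchingPartner e c a) ∨ R (matchingPartner e c a) a then
        s(a, matchingPartner e c a)
      else s(a, a)

/-- The functional dependencies `some c → none`, for all colours `c`. -/
noncomputable def matchingDeps (A : Type u) [Fintype A] : Finset (Dep (Option A)) :=
  Finset.univ.image fun c => Dep.fd [some c] [none]

theorem conflict_of_matchingVal_eq {A : Type u} {G : Type*} [AddCommGroup G]
    {R : A → A → Prop} {e : A ≃ G} {a b c : A} (hab : a ≠ b)
    (h : matchingVal R e a (some c) = matchingVal R e b (some c)) : R a b ∨ R b a := by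
  simp only [matchingVal] at h
  split_ifs at h <;> simp only [Sym2.eq_iff] at h <;> grind

theorem matchingVal_add_eq {A : Type u} {G : Type*} [AddCommGroup G]
    {R : A → A → Prop} (e : A ≃ G) {a b : A} (h : R a b) :
    matchingVal R e a (some (e.symm (e a + e b))) =
      matchingVal R e b (some (e.symm (e a + e b))) := by
  simp only [matchingVal, matchingPartner_add, matchingPartner_add_right, h, true_or, or_true,
    if_true, Sym2.eq_swap]

theorem confFree_iff_isRepair_matchingVal {A : Type u} [Fintype A] {G : Type*} [AddCommGroup G]
    {R : A → A → Prop} (hself : ∀ a, ¬ R a a) (e : A ≃ G) (S : Set A) :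
    ConfFree R S ↔ IsRepair (matchingVal R e) Set.univ (matchingDeps A : Set (Dep (Option A))) S := by
  constructor
  · refine fun hS => ⟨Set.subset_univ S, fun d hd => ?_⟩
    obtain ⟨c, -, rfl⟩ := Finset.mem_image.mp (Finset.mem_coe.mp hd)
    intro s hs t ht hst
    by_cases h : s = t
    · rw [h]
    · rcases conflict_of_matchingVal_eq h (List.singleton_inj.mp hst) with h' | h'
      exacts [(hS s hs t ht h').elim, (hS t ht s hs h').elim]
  · rintro ⟨-, hS⟩ a ha b hb hab
    have hsat := hS _ (Finset.mem_coe.mpr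
      (Finset.mem_image_of_mem _ (Finset.mem_univ (e.symm (e a + e b))))) a ha b hb
      (congrArg (fun v => [v]) (matchingVal_add_eq e hab))
    have hname : s(a, a) = s(b, b) := List.singleton_inj.mp hsat
    obtain rfl : a = b := by simpa using hname
    exact hself a hab

/-- For an AF `F = (A, R)` without self-attacking arguments with
`|A| = m`, there is a database instance with exactly `m` tuples (one tuple per argument),
at most `m + 1` attributes, and at most `m` functional dependencies such that for every
`S ⊆ A`: `S` is conflict-free in `F` iff the corresponding set of tuples is a repair of
the instance, and `S` is naive in `F` iff it is a maximal repair of the instance. -/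
theorem conflictFree_naive_small_db {A : Type u} [Fintype A] [Nonempty A]
    (R : A → A → Prop) (hself : ∀ a : A, ¬ R a a) (m : ℕ) (hm : Fintype.card A = m) :
    ∃ (α V : Type u) (inst : Fintype α) (val : A → α → V) (Fs : Finset (Dep α)),
      @Fintype.card α inst ≤ m + 1 ∧
      Fs.card ≤ m ∧
      (∀ d ∈ Fs, ∃ X Y, d = Dep.fd X Y) ∧
      ∀ S : Set A,
        (ConfFree R S ↔ IsRepair val Set.univ (↑Fs) S) ∧
        (NaiveExt R S ↔ IsMaximalRepair val Set.univ (↑Fs) S) := by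
  have : NeZero m := ⟨hm ▸ Fintype.card_ne_zero⟩
  let e : A ≃ ZMod m := Fintype.equivOfCardEq (hm.trans (ZMod.card m).symm)
  refine ⟨Option A, Sym2 A, inferInstance, matchingVal R e, matchingDeps A, ?_, ?_, ?_, ?_⟩
  · simp [hm]
  · exact Finset.card_image_le.trans hm.le
  · intro d hd
    obtain ⟨c, -, rfl⟩ := Finset.mem_image.mp hd
    exact ⟨_, _, rfl⟩
  · have h := confFree_iff_isRepair_matchingVal hself e
    exact fun S => ⟨h S, by simp only [NaiveExt, IsMaximalRepair, h]⟩
end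

section
/- Let F = (A, R) be an AF without self-attacking arguments and D_F = ⟨T, I⟩ its defense database. Then for every S ⊆ A: S defends itself in F (i.e., every a ∈ S is defended by S in F) if and only if S_T is a repair of D_F. -/
open scoped Classical

universe u

/-- For an AF `F = (A, R)` without self-attacking arguments and its
defense database `D_F`, a set `S ⊆ A` defends itself in `F` (every `a ∈ S` is defended
by `S`) iff the corresponding set of tuples `S_T` is a repair of `D_F`. -/
theorem defendsSelf_iff_repair {A : Type u} [Fintype A] [Nonempty A] (R : A → A → Prop)
    (hself : ∀ a : A, ¬ R a a) (S : Set A) :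
    (∀ a ∈ S, Defends R S a) ↔ IsRepair (defVal R) Set.univ (defDeps R) S := by
  constructor
  · rintro h
    refine ⟨Set.subset_univ S, ?_⟩
    rintro _ ⟨b, rfl⟩ s hs
    by_cases hsb : R s b
    · exact ⟨s, hs, by simp [defVal, hsb]⟩
    · by_cases hbs : R b s
      · obtain ⟨c, hc, hcb⟩ := h s hs b hbs
        exact ⟨c, hc, by simp [defVal, hbs, hcb]⟩
      · exact ⟨s, hs, by simp [defVal, hsb, hbs]⟩
  · rintro ⟨-, h⟩ a ha b hba
    obtain ⟨c, hc, hcb⟩ := h _ ⟨b, rfl⟩ a ha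
    refine ⟨c, hc, ?_⟩
    by_contra hn
    simp [defVal, hba, hn] at hcb
end

section
/- Let F = (A, R) be an AF and A_F = ⟨T, F ∪ I ∪ {i_s}⟩ its AF-database. Then for every S ⊆ A: S is admissible in F if and only if S_T is a repair of A_F. -/
open scoped Classical

universe u

theorem forall_satDep_afFDs_iff {A : Type u} (R : A → A → Prop) (S : Set A) :
    (∀ d ∈ afFDs A R, satDep (afVal R) S d) ↔ ∀ a ∈ S, ∀ b ∈ S, a ≠ b → ¬ R a b := by
  constructor
  · intro h a ha b hb hab hR
    have hd := h _ ⟨⟨s(a, b), a, b, rfl, hab, Or.inl hR⟩, rfl⟩ a ha b hb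
    simp [afVal, hab] at hd
  · rintro h _ ⟨⟨_, a, b, rfl, hab, hR⟩, rfl⟩ s hs t ht hst
    by_contra hne
    have hne : s ≠ t := fun e => hne (by rw [e])
    have h₁ := h s hs t ht hne
    have h₂ := h t ht s hs hne.symm
    simp only [afVal, List.map_cons, List.map_nil, Sym2.mem_iff] at hst
    grind

theorem forall_satDep_afIDs_iff {A : Type u} (R : A → A → Prop) (S : Set A) :
    (∀ d ∈ afIDs A R, satDep (afVal R) S d) ↔
      ∀ a ∈ S, ∀ b, a ≠ b → R a b ∨ R b a → ∃ c ∈ S, c ≠ b ∧ R c b := by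
  constructor
  · intro h a ha b hab hR
    obtain ⟨c, hc, hac⟩ := h _ ⟨b, rfl⟩ a ha
    refine ⟨c, hc, ?_⟩
    simp only [afVal, List.map_cons, List.map_nil] at hac
    grind
  · rintro h _ ⟨b, rfl⟩ a ha
    by_cases hab : a ≠ b ∧ (R a b ∨ R b a)
    · obtain ⟨c, hc, hcb⟩ := h a ha b hab.1 hab.2
      exact ⟨c, hc, by simp [afVal, hab, hcb]⟩
    · refine ⟨a, ha, ?_⟩
      have hab' : ¬ (a ≠ b ∧ R a b) := fun hv => hab ⟨hv.1, Or.inl hv.2⟩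
      simp only [afVal, List.map_cons, List.map_nil, if_neg hab, if_neg hab']

theorem satDep_afIs_iff {A : Type u} (R : A → A → Prop) (S : Set A) :
    satDep (afVal R) S (afIs A R) ↔ ∀ a ∈ S, ¬ R a a := by
  constructor
  · intro h a ha hR
    obtain ⟨t, -, hat⟩ := h a ha
    simp [afVal, hR] at hat
  · intro h a ha
    exact ⟨a, ha, by simp [afVal, h a ha]⟩

theorem isRepair_afDeps_iff {A : Type u} (R : A → A → Prop) (S : Set A) :
    IsRepair (afVal R) Set.univ (afDeps A R) S ↔
      (∀ a ∈ S, ∀ b ∈ S, a ≠ b → ¬ R a b) ∧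
      (∀ a ∈ S, ∀ b, a ≠ b → R a b ∨ R b a → ∃ c ∈ S, c ≠ b ∧ R c b) ∧
      ∀ a ∈ S, ¬ R a a := by
  rw [← forall_satDep_afFDs_iff, ← forall_satDep_afIDs_iff, ← satDep_afIs_iff]
  simp only [IsRepair, afDeps, Set.subset_univ, true_and, Set.mem_union, or_imp, forall_and,
    Set.mem_singleton_iff, forall_eq, and_assoc]

/-- For an AF `F = (A, R)` and its AF-database `A_F = ⟨T, F ∪ I ∪ {i_s}⟩`,
a set `S ⊆ A` is admissible in `F` iff the corresponding set of tuples `S_T` is a repair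
of `A_F`. -/
theorem admissible_iff_repair {A : Type u} [Fintype A] [Nonempty A] (R : A → A → Prop)
    (S : Set A) :
    AdmissibleExt R S ↔ IsRepair (afVal R) Set.univ (afDeps A R) S := by
  rw [isRepair_afDeps_iff]
  constructor
  · rintro ⟨hcf, hdef⟩
    refine ⟨fun a ha b hb _ => hcf a ha b hb, ?_, fun a ha => hcf a ha a ha⟩
    rintro a ha b hab (hR | hR)
    · exact ⟨a, ha, hab, hR⟩
    · obtain ⟨c, hc, hcb⟩ := hdef a ha b hR
      refine ⟨c, hc, ?_, hcb⟩
      rintro rfl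
      exact hcf c hc a ha hR
  · rintro ⟨hne, hdef, hself⟩
    refine ⟨fun a ha b hb hR => ?_, fun a ha b hR => ?_⟩
    · rcases eq_or_ne a b with rfl | hab
      · exact hself a ha hR
      · exact hne a ha b hb hab hR
    · have hab : a ≠ b := by
        rintro rfl
        exact hself a ha hR
      obtain ⟨c, hc, -, hcb⟩ := hdef a ha b hab (Or.inr hR)
      exact ⟨c, hc, hcb⟩
end

section
/- Let F = (A, R) be an AF and A_F = ⟨T, F ∪ I ∪ {i_s}⟩ its AF-database with range attributes X_r. Then for every set S ⊆ A of arguments and corresponding set S_T ⊆ T of tuples, S⁺ = dom(S_T[X_r]) ∖ {0}. -/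
open scoped Classical

universe u

/-- For an AF `F = (A, R)` and its AF-database `A_F` with range
attributes `X_r = {v_a : a ∈ A} ∪ {n}`: for every `S ⊆ A` and corresponding set of tuples
`S_T`, the range `S⁺` equals `dom(S_T[X_r]) ∖ {0}` (arguments being embedded into the
value space as `some ∘ Sum.inl`, and `0` being `none`). -/
theorem range_eq_domOn {A : Type u} [Fintype A] [Nonempty A] (R : A → A → Prop)
    (S : Set A) :
    (fun b : A => (some (Sum.inl b) : Option (A ⊕ Sym2 A))) '' AFRange R S =
      domOn (afVal R) S (rangeAttrs A R) \ {none} := by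
  ext v
  constructor
  · rintro ⟨b, hb, rfl⟩
    refine ⟨?_, by simp⟩
    by_cases hbS : b ∈ S
    · exact ⟨b, hbS, Sum.inl (Sum.inr ()), Or.inr rfl, rfl⟩
    · obtain hb | ⟨a, ha, hab⟩ := hb
      · exact absurd hb hbS
      · have hne : a ≠ b := fun h => hbS (h ▸ ha)
        exact ⟨a, ha, Sum.inr (Sum.inl (Sum.inr b)), Or.inl ⟨b, rfl⟩, if_pos ⟨hne, hab⟩⟩
  · rintro ⟨⟨a, ha, x, ⟨b, rfl⟩ | rfl, rfl⟩, hv⟩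
    · by_cases h : a ≠ b ∧ R a b
      · exact ⟨b, Or.inr ⟨a, ha, h.2⟩, (if_pos h).symm⟩
      · exact absurd (if_neg h) hv
    · exact ⟨a, Or.inl ha, rfl⟩
end

section
/- Let F = (A, R) be an AF, A_F = ⟨T, F ∪ I ∪ {i_s}⟩ its AF-database, and C = ⟨T, F ∪ {i_s}⟩ the instance with the same table T but only the FDs F and the ID i_s. Then for every S ⊆ A: S is stable in F if and only if S_T is a fully covering repair of C with respect to the range attributes X_r. -/
open scoped Classical

universe u

/-- The repairs of `⟨T, F ∪ {i_s}⟩` are exactly the conflict-free sets. -/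
theorem isRepair_afFDs_union_afIs_iff {A : Type u} (R : A → A → Prop) (S : Set A) :
    IsRepair (afVal R) Set.univ (afFDs A R ∪ {afIs A R}) S ↔ ConfFree R S := by
  constructor
  · rintro ⟨-, hdep⟩ a ha b hb hab
    by_cases hne : a = b
    · subst hne
      obtain ⟨t, -, ht⟩ := hdep (afIs A R) (Or.inr rfl) a ha
      simp [afVal, hab] at ht
    · have hfd := hdep _ (Or.inl ⟨⟨s(a, b), a, b, rfl, hne, Or.inl hab⟩, rfl⟩) a ha b hb
      simp [afVal, hne] at hfd
  · intro hcf
    refine ⟨Set.subset_univ S, ?_⟩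
    rintro d (⟨⟨r, p, q, rfl, -, hpq⟩, rfl⟩ | rfl)
    · intro a ha b hb hab
      have := hcf a ha b hb
      have := hcf b hb a ha
      simp only [afVal, List.map_cons, List.map_nil, List.cons.injEq, and_true, Sym2.mem_iff,
        Option.some.injEq, Sum.inl.injEq] at hab ⊢
      split_ifs at hab <;> grind
    · intro a ha
      exact ⟨a, ha, by simp [afVal, hcf a ha a ha]⟩

/-- A name occurs in the range attributes of `S` exactly when it lies in the range of `S`. -/
theorem some_inl_mem_domOn_rangeAttrs_iff {A : Type u} (R : A → A → Prop) (S : Set A) (b : A) :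
    some (Sum.inl b) ∈ domOn (afVal R) S (rangeAttrs A R) ↔ b ∈ AFRange R S := by
  constructor
  · rintro ⟨s, hs, x, ⟨a, rfl⟩ | rfl, hx⟩
    · simp only [afVal] at hx
      split_ifs at hx with h
      obtain rfl : a = b := by simpa using hx
      exact Or.inr ⟨s, hs, h.2⟩
    · obtain rfl : s = b := by simpa [afVal] using hx
      exact Or.inl hs
  · intro hb
    by_cases hbS : b ∈ S
    · exact ⟨b, hbS, _, Or.inr rfl, rfl⟩
    · obtain ⟨a, ha, hab⟩ := hb.resolve_left hbS
      have hne : a ≠ b := fun h => hbS (h ▸ ha)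
      exact ⟨a, ha, _, Or.inl ⟨b, rfl⟩, by simp [afVal, hne, hab]⟩

/-- The range attributes of `S` are fully covered exactly when the range of `S` is everything. -/
theorem domOn_rangeAttrs_eq_univ_iff {A : Type u} [Nonempty A] (R : A → A → Prop) (S : Set A) :
    domOn (afVal R) S (rangeAttrs A R) = domOn (afVal R) Set.univ (rangeAttrs A R) ↔
      AFRange R S = Set.univ := by
  constructor
  · intro h
    refine Set.eq_univ_of_forall fun b => ?_
    rw [← some_inl_mem_domOn_rangeAttrs_iff, h, some_inl_mem_domOn_rangeAttrs_iff]
    exact Or.inl trivial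
  · intro h
    obtain ⟨c, hc⟩ : S.Nonempty := by
      obtain ⟨b⟩ := ‹Nonempty A›
      rcases h.ge (Set.mem_univ b) with hb | ⟨a, ha, -⟩
      exacts [⟨b, hb⟩, ⟨a, ha⟩]
    refine Set.Subset.antisymm ?_ ?_
    · rintro v ⟨s, -, x, hx, rfl⟩
      exact ⟨s, trivial, x, hx, rfl⟩
    · rintro v ⟨s, -, x, ⟨a, rfl⟩ | rfl, rfl⟩
      · by_cases hsa : s ≠ a ∧ R s a
        · simpa [afVal, hsa] using
            (some_inl_mem_domOn_rangeAttrs_iff R S a).2 (h.ge (Set.mem_univ a))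
        · exact ⟨c, hc, _, Or.inl ⟨c, rfl⟩, by simp [afVal, hsa]⟩
      · exact (some_inl_mem_domOn_rangeAttrs_iff R S s).2 (h.ge (Set.mem_univ s))

/-- For an AF `F = (A, R)`, its AF-database `A_F = ⟨T, F ∪ I ∪ {i_s}⟩`,
and the instance `C = ⟨T, F ∪ {i_s}⟩` over the same table: a set `S ⊆ A` is stable in `F`
iff the corresponding set of tuples `S_T` is a fully covering repair of `C` with respect
to the range attributes `X_r` (a repair with `dom(S_T[X_r]) = dom(T[X_r])`). -/
theorem stable_iff_fullyCoveringRepair {A : Type u} [Fintype A] [Nonempty A]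
    (R : A → A → Prop) (S : Set A) :
    StableExt R S ↔
      (IsRepair (afVal R) Set.univ (afFDs A R ∪ {afIs A R}) S ∧
        domOn (afVal R) S (rangeAttrs A R) =
          domOn (afVal R) Set.univ (rangeAttrs A R)) := by
  rw [isRepair_afFDs_union_afIs_iff, domOn_rangeAttrs_eq_univ_iff, Set.eq_univ_iff_forall]
  exact and_congr_right fun _ => forall_congr' fun b => or_iff_not_imp_left.symm
end

section
/- Let F = (A, R) be an AF, A_F = ⟨T, F ∪ I ∪ {i_s}⟩ its AF-database, and C = ⟨T, F ∪ {i_s}⟩ the instance with the same table T but only the FDs F and the ID i_s. Then for every S ⊆ A: S is stage in F if and only if S_T is a maximally covering repair of C with respect to the range attributes X_r. -/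
open scoped Classical

universe u

theorem isRepair_afFDs_afIs_iff_confFree {A : Type u} (R : A → A → Prop) (P : Set A) :
    IsRepair (afVal R) Set.univ (afFDs A R ∪ {afIs A R}) P ↔ ConfFree R P := by
  constructor
  · rintro ⟨-, h⟩ a ha b hb hab
    by_cases hne : a = b
    · subst hne
      obtain ⟨t, -, ht⟩ := h (afIs A R) (Or.inr rfl) a ha
      simp [afVal, hab] at ht
    · have hfd := h _ (Or.inl ⟨⟨s(a, b), a, b, rfl, hne, Or.inl hab⟩, rfl⟩) a ha b hb
      simp [afVal, hne] at hfd
  · refine fun h => ⟨Set.subset_univ P, ?_⟩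
    rintro d (⟨⟨r, a, b, rfl, hne, hab⟩, rfl⟩ | rfl)
    · intro s hs t ht hst
      have hsub : s = t := by
        by_cases hs' : s ∈ s(a, b) <;> by_cases ht' : t ∈ s(a, b) <;>
          simp only [afVal, List.map_cons, List.map_nil, hs', ht', if_true, if_false] at hst
        · have h1 := h s hs t ht
          have h2 := h t ht s hs
          rw [Sym2.mem_iff] at hs' ht'
          grind
        · simp at hst
        · simp at hst
        · simpa using hst
      rw [hsub]
    · intro s hs
      exact ⟨s, hs, by simp [afVal, h s hs s hs]⟩

theorem some_inl_mem_domOn_rangeAttrs {A : Type u} (R : A → A → Prop) (P : Set A) (a : A) :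
    some (Sum.inl a) ∈ domOn (afVal R) P (rangeAttrs A R) ↔ a ∈ AFRange R P := by
  constructor
  · rintro ⟨s, hs, x, ⟨b, rfl⟩ | rfl, hx⟩
    · by_cases hsb : s ≠ b ∧ R s b
      · simp only [afVal, if_pos hsb, Option.some.injEq, Sum.inl.injEq] at hx
        exact Or.inr ⟨s, hs, hx ▸ hsb.2⟩
      · simp [afVal, if_neg hsb] at hx
    · simp only [afVal, Option.some.injEq, Sum.inl.injEq] at hx
      exact Or.inl (hx ▸ hs)
  · intro ha
    by_cases haP : a ∈ P
    · exact ⟨a, haP, _, Or.inr rfl, rfl⟩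
    · obtain ⟨b, hb, hba⟩ := ha.resolve_left haP
      have hne : b ≠ a := fun h => haP (h ▸ hb)
      exact ⟨b, hb, _, Or.inl ⟨a, rfl⟩, by simp [afVal, hne, hba]⟩

theorem some_inr_notMem_domOn_rangeAttrs {A : Type u} (R : A → A → Prop) (P : Set A)
    (r : Sym2 A) : some (Sum.inr r) ∉ domOn (afVal R) P (rangeAttrs A R) := by
  rintro ⟨s, -, x, ⟨b, rfl⟩ | rfl, hx⟩
  · by_cases hsb : s ≠ b ∧ R s b <;> simp [afVal, hsb] at hx
  · simp [afVal] at hx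

theorem none_mem_domOn_rangeAttrs {A : Type u} (R : A → A → Prop) (P : Set A) :
    none ∈ domOn (afVal R) P (rangeAttrs A R) ↔ P.Nonempty :=
  ⟨fun ⟨s, hs, _⟩ => ⟨s, hs⟩, fun ⟨s, hs⟩ => ⟨s, hs, _, Or.inl ⟨s, rfl⟩, by simp [afVal]⟩⟩

theorem nonempty_of_AFRange_nonempty {A : Type u} {R : A → A → Prop} {P : Set A}
    (h : (AFRange R P).Nonempty) : P.Nonempty := by
  obtain ⟨a, ha | ⟨b, hb, -⟩⟩ := h
  exacts [⟨a, ha⟩, ⟨b, hb⟩]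

theorem domOn_rangeAttrs_subset_iff {A : Type u} (R : A → A → Prop) (P Q : Set A) :
    domOn (afVal R) P (rangeAttrs A R) ⊆ domOn (afVal R) Q (rangeAttrs A R) ↔
      AFRange R P ⊆ AFRange R Q := by
  constructor
  · intro h a ha
    exact (some_inl_mem_domOn_rangeAttrs R Q a).1
      (h ((some_inl_mem_domOn_rangeAttrs R P a).2 ha))
  · rintro h (_ | a | r) hv
    · obtain ⟨s, hs⟩ := (none_mem_domOn_rangeAttrs R P).1 hv
      exact (none_mem_domOn_rangeAttrs R Q).2
        (nonempty_of_AFRange_nonempty ⟨s, h (Or.inl hs)⟩)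
    · exact (some_inl_mem_domOn_rangeAttrs R Q a).2
        (h ((some_inl_mem_domOn_rangeAttrs R P a).1 hv))
    · exact absurd hv (some_inr_notMem_domOn_rangeAttrs R P r)

/-- For an AF `F = (A, R)`, its AF-database `A_F = ⟨T, F ∪ I ∪ {i_s}⟩`,
and the instance `C = ⟨T, F ∪ {i_s}⟩` over the same table: a set `S ⊆ A` is stage in `F`
iff the corresponding set of tuples `S_T` is a maximally covering repair of `C` with
respect to the range attributes `X_r` (a repair such that no repair `P'` of `C` has
`dom(P'[X_r]) ⊋ dom(S_T[X_r])`). -/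
theorem stage_iff_maxCoveringRepair {A : Type u} [Fintype A] [Nonempty A]
    (R : A → A → Prop) (S : Set A) :
    StageExt R S ↔
      (IsRepair (afVal R) Set.univ (afFDs A R ∪ {afIs A R}) S ∧
        ∀ P' : Set A, IsRepair (afVal R) Set.univ (afFDs A R ∪ {afIs A R}) P' →
          ¬ domOn (afVal R) S (rangeAttrs A R) ⊂ domOn (afVal R) P' (rangeAttrs A R)) := by
  simp only [StageExt, isRepair_afFDs_afIs_iff_confFree, ssubset_iff_subset_not_subset,
    domOn_rangeAttrs_subset_iff]
end

section
/- Let F = (A, R) be a symmetric AF (i.e., (a, b) ∈ R if and only if (b, a) ∈ R for all a, b ∈ A) without self-attacking arguments, and let C_F = ⟨T, F⟩ be its conflict database. Then for every S ⊆ A the following are equivalent: (i) S is naive in F; (ii) S is stable in F; (iii) S is preferred in F; (iv) S_T is a maximal repair of C_F. -/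
open scoped Classical

universe u

theorem AdmissibleExt.iff_confFree_of_symm {A : Type u} {R : A → A → Prop}
    (hsym : ∀ a b : A, R a b ↔ R b a) (S : Set A) :
    AdmissibleExt R S ↔ ConfFree R S :=
  ⟨fun h => h.1, fun h => ⟨h, fun a ha b hb => ⟨a, ha, (hsym a b).2 hb⟩⟩⟩

theorem NaiveExt.iff_stableExt_of_symm {A : Type u} {R : A → A → Prop}
    (hsym : ∀ a b : A, R a b ↔ R b a) (hself : ∀ a : A, ¬ R a a) (S : Set A) :
    NaiveExt R S ↔ StableExt R S := by
  refine and_congr_right fun hS => ⟨fun h b hb => ?_, fun h S' hS' hlt => ?_⟩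
  · by_contra! hno
    refine h (insert b S) ?_ (Set.ssubset_insert hb)
    rintro x (rfl | hx) y (rfl | hy) hxy
    · exact hself _ hxy
    · exact hno y hy ((hsym _ _).1 hxy)
    · exact hno x hx hxy
    · exact hS x hx y hy hxy
  · obtain ⟨b, hb, hbS⟩ := Set.exists_of_ssubset hlt
    obtain ⟨a, ha, hab⟩ := h b hbS
    exact hS' a (hlt.1 ha) b hb hab

theorem confVal_some_eq_iff {A : Type u} {R : A → A → Prop} {a b : A}
    (r : {r : Sym2 A // IsConflict R r}) :
    confVal R a (some r) = confVal R b (some r) ↔ a = b ∨ (a ∈ r.1 ∧ b ∈ r.1) := by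
  by_cases ha : a ∈ r.1 <;> by_cases hb : b ∈ r.1 <;> simp [confVal, ha, hb] <;>
    rintro rfl <;> contradiction

/-- Repairs of the conflict database are the conflict-free sets. -/
theorem isRepair_confVal_iff {A : Type u} {R : A → A → Prop}
    (hself : ∀ a : A, ¬ R a a) (P : Set A) :
    IsRepair (confVal R) Set.univ (confDeps R) P ↔ ConfFree R P := by
  constructor
  · rintro ⟨-, h⟩ a ha b hb hab
    have key := h _ ⟨⟨s(a, b), a, b, rfl, Or.inl hab⟩, rfl⟩ a ha b hb
      (by simp [confVal])
    obtain rfl : a = b := by simpa [confVal] using key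
    exact hself a hab
  · refine fun h => ⟨Set.subset_univ P, ?_⟩
    rintro _ ⟨⟨r, c, d, rfl, hcd⟩, rfl⟩ a ha b hb hab
    simp only [List.map_cons, List.map_nil, List.cons.injEq, and_true,
      confVal_some_eq_iff, Sym2.mem_iff] at hab
    suffices a = b by rw [this]
    have := h a ha b hb
    have := h b hb a ha
    grind

/-- For a symmetric AF `F = (A, R)` without self-attacking arguments
and its conflict database `C_F`, the following are equivalent for every `S ⊆ A`:
(i) `S` is naive in `F`; (ii) `S` is stable in `F`; (iii) `S` is preferred in `F`;
(iv) the corresponding set of tuples `S_T` is a maximal repair of `C_F`. -/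
theorem symmetric_naive_stable_preferred_maximalRepair {A : Type u} [Fintype A]
    [Nonempty A] (R : A → A → Prop) (hsym : ∀ a b : A, R a b ↔ R b a)
    (hself : ∀ a : A, ¬ R a a) (S : Set A) :
    (NaiveExt R S ↔ StableExt R S) ∧
    (StableExt R S ↔ PreferredExt R S) ∧
    (PreferredExt R S ↔ IsMaximalRepair (confVal R) Set.univ (confDeps R) S) := by
  simp only [NaiveExt.iff_stableExt_of_symm hsym hself S, PreferredExt, IsMaximalRepair,
    AdmissibleExt.iff_confFree_of_symm hsym, isRepair_confVal_iff hself, true_and,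
    and_true]
  exact (NaiveExt.iff_stableExt_of_symm hsym hself S).symm
end
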